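/- Weber's formula: if τ ∈ 𝔖₃ is the period matrix of a smooth plane quartic with Aronhold system of bitangents normalized as X₁=0, X₂=0, X₃=0, X₁+X₂+X₃=0, and a_{i1}X₁+a_{i2}X₂+a_{i3}X₃=0 for i=1,2,3, corresponding to quadratic forms q₁,…,q₇, then a_{ij} = η_i · e(q_j'·(q₄+q_{4+i})'') · θ(q₄+q_r+q_j)θ(q₄+q_s+q_j) / (θ(q_{4+i}+q_r+q_j)θ(q_{4+i}+q_s+q_j)), where {4+i, r, s} = {5,6,7}, e(x) = exp(πi x), and η_i is a nonzero scalar depending only on i. -/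

import Mathlib

open Complex

/-- The Riemann theta function with integer characteristic `(m', m'')`. -/
noncomputable def SiegelTheta (g : ℕ) (τ : Matrix (Fin g) (Fin g) ℂ)
    (z : Fin g → ℂ) (m' m'' : Fin g → ℤ) : ℂ :=
  ∑' n : Fin g → ℤ,
    Complex.exp (Real.pi * Complex.I *
      ((∑ i, ∑ j, ((n i : ℂ) + (m' i : ℂ) / 2) * τ i j * ((n j : ℂ) + (m' j : ℂ) / 2)) +
        2 * ∑ i, ((n i : ℂ) + (m' i : ℂ) / 2) * (z i + (m'' i : ℂ) / 2)))

/-- `τ` belongs to the Siegel upper half space. -/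
def InSiegelUpperHalfSpace {g : ℕ} (τ : Matrix (Fin g) (Fin g) ℂ) : Prop :=
  (∀ i j, τ i j = τ j i) ∧
  (∀ x : Fin g → ℝ, x ≠ 0 → 0 < ∑ i, ∑ j, x i * (τ i j).im * x j)

/-- The `i`-th component of the gradient of `θ_m(τ, ·)` at `z = 0`. -/
noncomputable def thetaGrad (g : ℕ) (τ : Matrix (Fin g) (Fin g) ℂ)
    (m' m'' : Fin g → ℤ) (i : Fin g) : ℂ :=
  fderiv ℂ (fun z : Fin g → ℂ => SiegelTheta g τ z m' m'') 0 (Pi.single i 1)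

/-- The Jacobian determinant `D[q_a, q_b, q_c]` of three theta gradients at
`z = 0`, for genus 3 and characteristics `c k = (m'_k, m''_k)`. -/
noncomputable def thetaJacDet (τ : Matrix (Fin 3) (Fin 3) ℂ)
    (c : Fin 3 → (Fin 3 → ℤ) × (Fin 3 → ℤ)) : ℂ :=
  Matrix.det (Matrix.of fun k i => thetaGrad 3 τ (c k).1 (c k).2 i)

/-- The theta constant `θ(q_a + q_b + q_c)` with the non-reduced characteristic
given by the integer sum of the three characteristics. -/
noncomputable def tripleThetaConst (τ : Matrix (Fin 3) (Fin 3) ℂ)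
    (m' m'' : Fin 7 → Fin 3 → ℤ) (a b c : Fin 7) : ℂ :=
  SiegelTheta 3 τ 0 (fun i => m' a i + m' b i + m' c i)
    (fun i => m'' a i + m'' b i + m'' c i)

/-- `(m', m'')` is a (genus 3) Aronhold system of characteristics: seven
distinct odd characteristics with entries in `{0, 1}`, every three of which are
azygetic (the characteristic sum of any three of them is even). -/
def IsAronholdChar (m' m'' : Fin 7 → Fin 3 → ℤ) : Prop :=
  (∀ k i, m' k i = 0 ∨ m' k i = 1) ∧
  (∀ k i, m'' k i = 0 ∨ m'' k i = 1) ∧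
  (∀ k, Odd (∑ i, m' k i * m'' k i)) ∧
  (∀ a b c : Fin 7, a ≠ b → a ≠ c → b ≠ c →
    Even (∑ i, (m' a i + m' b i + m' c i) * (m'' a i + m'' b i + m'' c i))) ∧
  Function.Injective (fun k => (m' k, m'' k))

/-- The coefficient vectors of the normalized Aronhold system of bitangents:
`X₁ = 0`, `X₂ = 0`, `X₃ = 0`, `X₁+X₂+X₃ = 0`, and
`a_{i1}X₁ + a_{i2}X₂ + a_{i3}X₃ = 0` for `i = 1, 2, 3`. -/
def lineCoeffs (a : Fin 3 → Fin 3 → ℂ) : Fin 7 → Fin 3 → ℂ :=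
  ![![1, 0, 0], ![0, 1, 0], ![0, 0, 1], ![1, 1, 1], a 0, a 1, a 2]

/-- For `i = 1, 2, 3` (0-based `i : Fin 3`), the 0-based index of `q_{4+i}`. -/
def fIdx : Fin 3 → Fin 7 := ![4, 5, 6]

/-- The 0-based indices `r` with `{4+i, r, s} = {5, 6, 7}` (1-based). -/
def rIdx : Fin 3 → Fin 7 := ![5, 4, 4]

/-- The 0-based indices `s` with `{4+i, r, s} = {5, 6, 7}` (1-based). -/
def sIdx : Fin 3 → Fin 7 := ![6, 6, 5]

noncomputable def thTerm (τ : Matrix (Fin 3) (Fin 3) ℂ)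
    (z : Fin 3 → ℂ) (m' m'' : Fin 3 → ℤ) (n : Fin 3 → ℤ) : ℂ :=
  Complex.exp (Real.pi * Complex.I *
      ((∑ i, ∑ j, ((n i : ℂ) + (m' i : ℂ) / 2) * τ i j * ((n j : ℂ) + (m' j : ℂ) / 2)) +
        2 * ∑ i, ((n i : ℂ) + (m' i : ℂ) / 2) * (z i + (m'' i : ℂ) / 2)))

theorem siegelTheta_eq (τ : Matrix (Fin 3) (Fin 3) ℂ) (z : Fin 3 → ℂ) (m' m'' : Fin 3 → ℤ) :
    SiegelTheta 3 τ z m' m'' = ∑' n, thTerm τ z m' m'' n := rfl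

theorem quad_lower (Y : Fin 3 → Fin 3 → ℝ)
    (hY : ∀ x : Fin 3 → ℝ, x ≠ 0 → 0 < ∑ i, ∑ j, x i * Y i j * x j) :
    ∃ c : ℝ, 0 < c ∧ ∀ x : Fin 3 → ℝ, c * ∑ i, x i ^ 2 ≤ ∑ i, ∑ j, x i * Y i j * x j := by
  have hcomp : IsCompact (Metric.sphere (0 : Fin 3 → ℝ) 1) := isCompact_sphere 0 1
  have hne : (Metric.sphere (0 : Fin 3 → ℝ) 1).Nonempty :=
    NormedSpace.sphere_nonempty.mpr zero_le_one
  have hcont : Continuous (fun x : Fin 3 → ℝ => ∑ i, ∑ j, x i * Y i j * x j) := by fun_prop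
  obtain ⟨x0, hx0, hmin⟩ := hcomp.exists_isMinOn hne hcont.continuousOn
  have hx0' : x0 ≠ 0 := by
    rintro rfl
    simp at hx0
  have hm := hY x0 hx0'
  set m := ∑ i, ∑ j, x0 i * Y i j * x0 j with hmdef
  refine ⟨m / 3, by positivity, fun x => ?_⟩
  by_cases hx : x = 0
  · subst hx; simp
  have hnx : 0 < ‖x‖ := norm_pos_iff.mpr hx
  have h1 := hmin (show ‖x‖⁻¹ • x ∈ Metric.sphere (0 : Fin 3 → ℝ) 1 by
    simp [norm_smul, hnx.ne'])
  have h2 : ∑ i, ∑ j, (‖x‖⁻¹ • x) i * Y i j * (‖x‖⁻¹ • x) j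
      = (‖x‖ ^ 2)⁻¹ * ∑ i, ∑ j, x i * Y i j * x j := by
    simp only [Finset.mul_sum, Pi.smul_apply, smul_eq_mul]
    refine Finset.sum_congr rfl fun i _ => Finset.sum_congr rfl fun j _ => ?_
    field_simp
  simp only [Set.mem_ofPred_eq] at h1
  rw [h2, ← hmdef] at h1
  have h3 : m * ‖x‖ ^ 2 ≤ ∑ i, ∑ j, x i * Y i j * x j := by
    have := mul_le_mul_of_nonneg_left h1 (show 0 ≤ ‖x‖ ^ 2 by positivity)
    rw [← mul_assoc, mul_inv_cancel₀ (by positivity), one_mul] at this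
    linarith
  have h4 : ∑ i, x i ^ 2 ≤ 3 * ‖x‖ ^ 2 := by
    have : ∀ i, x i ^ 2 ≤ ‖x‖ ^ 2 := fun i => by
      rw [← sq_abs]
      exact pow_le_pow_left₀ (abs_nonneg _) (norm_le_pi_norm x i) 2
    rw [Fin.sum_univ_three]
    linarith [this 0, this 1, this 2]
  nlinarith

theorem summable_one (A B a : ℝ) (hA : 0 < A) :
    Summable (fun n : ℤ => Real.exp (-A * ((n : ℝ) + a) ^ 2 + B * |(n : ℝ) + a|)) := by
  have h0 : Summable (fun n : ℤ => Real.exp (-|(n : ℝ)|)) := by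
    apply Summable.of_nat_of_neg
    · simpa using Real.summable_exp_neg_nat
    · simpa using Real.summable_exp_neg_nat
  refine Summable.of_nonneg_of_le (fun n => (Real.exp_pos _).le) (fun n => ?_)
    (h0.mul_left (Real.exp ((B + 1) ^ 2 / (4 * A) + |a|)))
  rw [← Real.exp_add]
  apply Real.exp_le_exp.mpr
  set t := (n : ℝ) + a with ht
  have h1 : |(n : ℝ)| ≤ |t| + |a| := by
    have : (n : ℝ) = t - a := by rw [ht]; ring
    rw [this]; exact abs_sub _ _
  have h2 : -A * t ^ 2 + (B + 1) * |t| ≤ (B + 1) ^ 2 / (4 * A) := by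
    rw [le_div_iff₀ (by positivity), ← sq_abs t]
    nlinarith [sq_nonneg (2 * A * |t| - (B + 1))]
  linarith

theorem summable_prod3 (f : Fin 3 → ℤ → ℝ) (hf : ∀ i, Summable (f i)) (h0 : ∀ i n, 0 ≤ f i n) :
    Summable (fun n : Fin 3 → ℤ => ∏ i, f i (n i)) := by
  have h := ((hf 0).mul_of_nonneg ((hf 1).mul_of_nonneg (hf 2) (h0 1) (h0 2)) (h0 0)
    (fun x => mul_nonneg (h0 1 _) (h0 2 _)))
  have hinj : Function.Injective (fun n : Fin 3 → ℤ => (n 0, n 1, n 2)) := by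
    intro a b hab
    simp only [Prod.mk.injEq] at hab
    ext i; fin_cases i <;> simp [hab]
  have := h.comp_injective hinj
  refine this.congr fun n => ?_
  simp [Fin.prod_univ_three, mul_assoc]

theorem norm_thTerm (τ : Matrix (Fin 3) (Fin 3) ℂ) (z : Fin 3 → ℂ) (a b n : Fin 3 → ℤ) :
    ‖thTerm τ z a b n‖ = Real.exp (-Real.pi *
      ((∑ i, ∑ j, ((n i : ℝ) + (a i : ℝ) / 2) * (τ i j).im * ((n j : ℝ) + (a j : ℝ) / 2)) +
        2 * ∑ i, ((n i : ℝ) + (a i : ℝ) / 2) * (z i).im)) := by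
  rw [thTerm, Complex.norm_exp]
  congr 1
  have h1 : ∀ i, ((n i : ℂ) + (a i : ℂ) / 2) = (((n i : ℝ) + (a i : ℝ) / 2 : ℝ) : ℂ) := by
    intro i; push_cast; rfl
  have h2 : ∀ i, (z i + (b i : ℂ) / 2).im = (z i).im := by
    intro i
    have : ((b i : ℂ) / 2) = (((b i : ℝ) / 2 : ℝ) : ℂ) := by push_cast; rfl
    rw [this, Complex.add_im, Complex.ofReal_im, add_zero]
  simp only [h1]
  have h3 : ∀ w : ℂ, ((Real.pi : ℂ) * Complex.I * w).re = -Real.pi * w.im := by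
    intro w; simp
  rw [h3]
  congr 1
  have h4 : ∀ (r s : ℝ) (w : ℂ), ((r : ℂ) * w * (s : ℂ)).im = r * w.im * s := by
    intro r s w; simp
  have h5 : ∀ w : ℂ, (2 * w).im = 2 * w.im := by intro w; simp
  rw [Complex.add_im, h5, Complex.im_sum, Complex.im_sum]
  simp only [Complex.im_sum, h4, Complex.im_ofReal_mul, h2]

theorem norm_thTerm_le (τ : Matrix (Fin 3) (Fin 3) ℂ) (hτ : InSiegelUpperHalfSpace τ) :
    ∃ c : ℝ, 0 < c ∧ ∀ (R : ℝ) (z : Fin 3 → ℂ) (a b n : Fin 3 → ℤ), ‖z‖ ≤ R →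
      ‖thTerm τ z a b n‖ ≤ ∏ i, Real.exp (-(Real.pi * c) * ((n i : ℝ) + (a i : ℝ) / 2) ^ 2
        + (2 * Real.pi * R) * |(n i : ℝ) + (a i : ℝ) / 2|) := by
  obtain ⟨c, hc, hq⟩ := quad_lower (fun i j => (τ i j).im) hτ.2
  refine ⟨c, hc, fun R z a b n hz => ?_⟩
  rw [norm_thTerm, ← Real.exp_sum]
  apply Real.exp_le_exp.mpr
  have h1 := hq (fun i => (n i : ℝ) + (a i : ℝ) / 2)
  have h2 : ∀ i, -(((n i : ℝ) + (a i : ℝ) / 2) * (z i).im) ≤ R * |(n i : ℝ) + (a i : ℝ) / 2| := by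
    intro i
    refine (neg_le_abs _).trans ?_
    rw [abs_mul, mul_comm]
    exact mul_le_mul_of_nonneg_right
      (((Complex.abs_im_le_norm _).trans (norm_le_pi_norm z i)).trans hz) (abs_nonneg _)
  rw [Finset.sum_add_distrib, ← Finset.mul_sum, ← Finset.mul_sum]
  have h3 : -∑ i, (((n i : ℝ) + (a i : ℝ) / 2) * (z i).im)
      ≤ R * ∑ i, |(n i : ℝ) + (a i : ℝ) / 2| := by
    rw [← Finset.sum_neg_distrib, Finset.mul_sum]
    exact Finset.sum_le_sum fun i _ => h2 i
  have hp := Real.pi_pos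
  nlinarith [mul_le_mul_of_nonneg_left h1 hp.le, mul_le_mul_of_nonneg_left h3 hp.le]

theorem summable_bound (A B : ℝ) (hA : 0 < A) (a : Fin 3 → ℤ) :
    Summable (fun n : Fin 3 → ℤ => ∏ i, Real.exp (-A * ((n i : ℝ) + (a i : ℝ) / 2) ^ 2
        + B * |(n i : ℝ) + (a i : ℝ) / 2|)) :=
  summable_prod3 (fun i k => Real.exp (-A * ((k : ℝ) + (a i : ℝ) / 2) ^ 2
        + B * |(k : ℝ) + (a i : ℝ) / 2|)) (fun i => summable_one A B _ hA)
    (fun _ _ => (Real.exp_pos _).le)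

theorem summable_norm_thTerm (τ : Matrix (Fin 3) (Fin 3) ℂ) (hτ : InSiegelUpperHalfSpace τ)
    (z : Fin 3 → ℂ) (a b : Fin 3 → ℤ) : Summable (fun n => ‖thTerm τ z a b n‖) := by
  obtain ⟨c, hc, h⟩ := norm_thTerm_le τ hτ
  exact Summable.of_nonneg_of_le (fun _ => norm_nonneg _) (fun n => h ‖z‖ z a b n le_rfl)
    (summable_bound _ _ (by have := Real.pi_pos; positivity) a)

theorem differentiableAt_theta (τ : Matrix (Fin 3) (Fin 3) ℂ) (hτ : InSiegelUpperHalfSpace τ)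
    (a b : Fin 3 → ℤ) : DifferentiableAt ℂ (fun z : Fin 3 → ℂ => SiegelTheta 3 τ z a b) 0 := by
  obtain ⟨c, hc, h⟩ := norm_thTerm_le τ hτ
  have hp := Real.pi_pos
  let L : (Fin 3 → ℤ) → ((Fin 3 → ℂ) →L[ℂ] ℂ) := fun n =>
    ((2 * Real.pi * Complex.I : ℂ)) • ∑ i, ((n i : ℂ) + (a i : ℂ) / 2) •
      (ContinuousLinearMap.proj (R := ℂ) (φ := fun _ : Fin 3 => ℂ) i)
  have hL : ∀ n, ‖L n‖ ≤ (2 * Real.pi) * ∏ i, Real.exp (|(n i : ℝ) + (a i : ℝ) / 2|) := by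
    intro n
    rw [norm_smul]
    have e1 : ‖(2 * Real.pi * Complex.I : ℂ)‖ = 2 * Real.pi := by
      simp [abs_of_pos hp]
    rw [e1]
    refine mul_le_mul_of_nonneg_left ?_ (by positivity)
    refine ContinuousLinearMap.opNorm_le_bound _ (by positivity) fun x => ?_
    rw [← Real.exp_sum]
    have e2 : ∑ i, |(n i : ℝ) + (a i : ℝ) / 2| ≤ Real.exp (∑ i, |(n i : ℝ) + (a i : ℝ) / 2|) := by
      linarith [Real.add_one_le_exp (∑ i, |(n i : ℝ) + (a i : ℝ) / 2|)]
    refine le_trans ?_ (mul_le_mul_of_nonneg_right e2 (norm_nonneg _))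
    rw [sum_apply, Finset.sum_mul]
    refine (norm_sum_le _ _).trans (Finset.sum_le_sum fun i _ => ?_)
    rw [smul_apply, norm_smul]
    have e3 : ‖((n i : ℂ) + (a i : ℂ) / 2)‖ = |(n i : ℝ) + (a i : ℝ) / 2| := by
      have : ((n i : ℂ) + (a i : ℂ) / 2) = (((n i : ℝ) + (a i : ℝ) / 2 : ℝ) : ℂ) := by
        push_cast; rfl
      rw [this, Complex.norm_real, Real.norm_eq_abs]
    rw [e3]
    exact mul_le_mul_of_nonneg_left (norm_le_pi_norm x i) (abs_nonneg _)
  have hd : ∀ n z, HasFDerivAt (fun z => thTerm τ z a b n) (thTerm τ z a b n • L n) z := by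
    intro n z
    unfold thTerm
    have hlin : HasFDerivAt (fun z : Fin 3 → ℂ => (Real.pi * Complex.I *
      ((∑ i, ∑ j, ((n i : ℂ) + (a i : ℂ) / 2) * τ i j * ((n j : ℂ) + (a j : ℂ) / 2)) +
        2 * ∑ i, ((n i : ℂ) + (a i : ℂ) / 2) * (z i + (b i : ℂ) / 2)) : ℂ)) (L n) z := by
      have h0 := ((L n).hasFDerivAt (x := z)).const_add (Real.pi * Complex.I *
        ((∑ i, ∑ j, ((n i : ℂ) + (a i : ℂ) / 2) * τ i j * ((n j : ℂ) + (a j : ℂ) / 2)) +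
        2 * ∑ i, ((n i : ℂ) + (a i : ℂ) / 2) * ((b i : ℂ) / 2)) : ℂ)
      refine h0.congr_of_eventuallyEq (Filter.Eventually.of_forall fun w => ?_)
      simp only [L, smul_apply, sum_apply,
        ContinuousLinearMap.proj_apply, smul_eq_mul, mul_add, Finset.sum_add_distrib]
      ring
    exact hlin.cexp
  have hb : ∀ n z, z ∈ Metric.ball (0 : Fin 3 → ℂ) 1 → ‖thTerm τ z a b n • L n‖ ≤
      (2 * Real.pi) * ∏ i, Real.exp (-(Real.pi * c) * ((n i : ℝ) + (a i : ℝ) / 2) ^ 2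
        + (2 * Real.pi * 1 + 1) * |(n i : ℝ) + (a i : ℝ) / 2|) := by
    intro n z hz
    have hz' : ‖z‖ ≤ 1 := by simpa using (mem_ball_zero_iff.mp hz).le
    rw [norm_smul]
    refine (mul_le_mul (h 1 z a b n hz') (hL n) (norm_nonneg _)
      (Finset.prod_nonneg fun _ _ => (Real.exp_pos _).le)).trans (le_of_eq ?_)
    rw [mul_left_comm, ← Finset.prod_mul_distrib]
    congr 1
    refine Finset.prod_congr rfl fun i _ => ?_
    rw [← Real.exp_add]; congr 1; ring
  have hs : Summable (fun n : Fin 3 → ℤ => (2 * Real.pi) *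
      ∏ i, Real.exp (-(Real.pi * c) * ((n i : ℝ) + (a i : ℝ) / 2) ^ 2
        + (2 * Real.pi * 1 + 1) * |(n i : ℝ) + (a i : ℝ) / 2|)) :=
    (summable_bound _ _ (by positivity) a).mul_left _
  have h0 : (0 : Fin 3 → ℂ) ∈ Metric.ball (0 : Fin 3 → ℂ) 1 := by simp
  exact (hasFDerivAt_tsum_of_isPreconnected hs Metric.isOpen_ball
    (convex_ball _ _).isPreconnected (fun n z _ => hd n z) (fun n z hz => hb n z hz) h0
    (summable_norm_thTerm τ hτ 0 a b).of_norm h0).differentiableAt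

noncomputable def eps (k : ℤ) : ℂ := Complex.exp (Real.pi * Complex.I * (k : ℂ))

theorem eps_add (k l : ℤ) : eps (k + l) = eps k * eps l := by
  unfold eps; rw [← Complex.exp_add]; congr 1; push_cast; ring

theorem eps_two_mul (k : ℤ) : eps (2 * k) = 1 := by
  unfold eps
  rw [show (Real.pi * Complex.I * ((2 * k : ℤ) : ℂ)) = (k : ℂ) * (2 * Real.pi * Complex.I) by
    push_cast; ring]
  exact Complex.exp_int_mul_two_pi_mul_I k

theorem eps_even {k : ℤ} (h : Even k) : eps k = 1 := by
  obtain ⟨m, rfl⟩ := h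
  rw [← two_mul, eps_two_mul]

theorem eps_odd {k : ℤ} (h : Odd k) : eps k = -1 := by
  obtain ⟨m, rfl⟩ := h
  rw [eps_add, eps_two_mul, one_mul]
  unfold eps; simp [Complex.exp_pi_mul_I]

theorem eps_zero : eps 0 = 1 := eps_even ⟨0, rfl⟩

theorem eps_congr {k l : ℤ} (h : Even (k - l)) : eps k = eps l := by
  have : k = (k - l) + l := by ring
  rw [this, eps_add, eps_even h, one_mul]

theorem eps_ne_zero (k : ℤ) : eps k ≠ 0 := Complex.exp_ne_zero _

theorem eps_sq (k : ℤ) : eps k * eps k = 1 := by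
  rw [← eps_add, ← two_mul, eps_two_mul]

/-- exponent of the theta series -/
noncomputable def thE (τ : Matrix (Fin 3) (Fin 3) ℂ) (x w : Fin 3 → ℂ) : ℂ :=
  (∑ i, ∑ j, x i * τ i j * x j) + 2 * ∑ i, x i * w i

theorem thTerm_eq (τ : Matrix (Fin 3) (Fin 3) ℂ) (z : Fin 3 → ℂ) (a b n : Fin 3 → ℤ) :
    thTerm τ z a b n = Complex.exp (Real.pi * Complex.I *
      thE τ (fun i => (n i : ℂ) + (a i : ℂ) / 2) (fun i => z i + (b i : ℂ) / 2)) := rfl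

theorem theta_odd_zero (τ : Matrix (Fin 3) (Fin 3) ℂ) (a b : Fin 3 → ℤ)
    (h : Odd (∑ i, a i * b i)) : SiegelTheta 3 τ 0 a b = 0 := by
  have key : ∀ n : Fin 3 → ℤ, thTerm τ 0 a b (-n - a) = - thTerm τ 0 a b n := by
    intro n
    have h1 : thTerm τ 0 a b (-n - a) =
        eps (-(2 * ∑ i, n i * b i) - ∑ i, a i * b i) * thTerm τ 0 a b n := by
      unfold thTerm eps
      rw [← Complex.exp_add]
      congr 1
      simp only [Fin.sum_univ_three, Pi.sub_apply, Pi.neg_apply, Pi.zero_apply]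
      push_cast
      ring
    rw [h1, eps_odd]
    · ring
    · rw [Int.odd_sub]
      constructor
      · intro h'; exact absurd h' (by simp)
      · intro h'; exact absurd h (by simpa using h')
  rw [siegelTheta_eq]
  have h2 := (Equiv.ofBijective (fun n : Fin 3 → ℤ => -n - a)
    (Function.Involutive.bijective (fun n => by simp))).tsum_eq (thTerm τ 0 a b)
  simp only [Equiv.ofBijective_apply, key, tsum_neg] at h2
  have : (2 : ℂ) * ∑' n, thTerm τ 0 a b n = 0 := by linear_combination -h2
  simpa using this

theorem thE_orth (τ : Matrix (Fin 3) (Fin 3) ℂ) (B1 B2 B3 B4 w1 w2 w3 w4 : Fin 3 → ℂ) :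
    thE τ (fun i => (B1 i + B2 i + B3 i + B4 i) / 2) w1
    + thE τ (fun i => (B1 i + B2 i - B3 i - B4 i) / 2) w2
    + thE τ (fun i => (B1 i - B2 i + B3 i - B4 i) / 2) w3
    + thE τ (fun i => (B1 i - B2 i - B3 i + B4 i) / 2) w4
    = thE τ B1 (fun i => (w1 i + w2 i + w3 i + w4 i) / 2)
    + thE τ B2 (fun i => (w1 i + w2 i - w3 i - w4 i) / 2)
    + thE τ B3 (fun i => (w1 i - w2 i + w3 i - w4 i) / 2)
    + thE τ B4 (fun i => (w1 i - w2 i - w3 i + w4 i) / 2) := by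
  simp only [thE, Fin.sum_univ_three]
  ring

theorem prod4_tsum {ι : Type} (f1 f2 f3 f4 : ι → ℂ) (h1 : Summable fun n => ‖f1 n‖)
    (h2 : Summable fun n => ‖f2 n‖) (h3 : Summable fun n => ‖f3 n‖)
    (h4 : Summable fun n => ‖f4 n‖) :
    (∑' n, f1 n) * ((∑' n, f2 n) * ((∑' n, f3 n) * (∑' n, f4 n))) =
      ∑' N : ι × ι × ι × ι, f1 N.1 * (f2 N.2.1 * (f3 N.2.2.1 * f4 N.2.2.2)) ∧
    Summable (fun N : ι × ι × ι × ι => f1 N.1 * (f2 N.2.1 * (f3 N.2.2.1 * f4 N.2.2.2))) := by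
  have h34 := h3.mul_norm h4
  have h234 := h2.mul_norm h34
  have h1234 := h1.mul_norm h234
  refine ⟨?_, h1234.of_norm⟩
  rw [tsum_mul_tsum_of_summable_norm h3 h4, tsum_mul_tsum_of_summable_norm h2 h34,
    tsum_mul_tsum_of_summable_norm h1 h234]

/-- bits -/
def bz (r : Fin 3 → Fin 2) : Fin 3 → ℤ := fun i => ((r i : ℕ) : ℤ)

theorem sum_bits (f : (Fin 3 → Fin 2) → ℂ) :
    ∑ p, f p = ∑ p0 : Fin 2, ∑ p1 : Fin 2, ∑ p2 : Fin 2, f ![p0, p1, p2] := by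
  rw [← (Fin.consEquiv (fun _ : Fin 3 => Fin 2)).sum_comp, Fintype.sum_prod_type]
  refine Finset.sum_congr rfl fun p0 _ => ?_
  rw [← (Fin.consEquiv (fun _ : Fin 2 => Fin 2)).sum_comp, Fintype.sum_prod_type]
  refine Finset.sum_congr rfl fun p1 _ => ?_
  rw [← (Fin.consEquiv (fun _ : Fin 1 => Fin 2)).sum_comp, Fintype.sum_prod_type]
  refine Finset.sum_congr rfl fun p2 _ => ?_
  rw [Fintype.sum_unique]
  rfl

theorem sum_eps (s k : Fin 3 → ℤ) :
    ∑ p : Fin 3 → Fin 2, eps (∑ i, (bz p i + s i) * k i) =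
      eps (∑ i, s i * k i) * ((1 + eps (k 0)) * ((1 + eps (k 1)) * (1 + eps (k 2)))) := by
  rw [sum_bits]
  simp only [Fin.sum_univ_two, Fin.sum_univ_three, bz]
  simp [add_mul, eps_add]
  ring

theorem sum_eps_even (s k : Fin 3 → ℤ) (h : ∀ i, Even (k i)) :
    ∑ p : Fin 3 → Fin 2, eps (∑ i, (bz p i + s i) * k i) = 8 := by
  rw [sum_eps, eps_even (h 0), eps_even (h 1), eps_even (h 2), eps_even]
  · norm_num
  · exact Finset.even_sum _ fun i _ => (h i).mul_left _

theorem sum_eps_odd (s k : Fin 3 → ℤ) (h : ¬ ∀ i, Even (k i)) :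
    ∑ p : Fin 3 → Fin 2, eps (∑ i, (bz p i + s i) * k i) = 0 := by
  rw [sum_eps]
  push Not at h
  obtain ⟨i, hi⟩ := h
  rw [Int.not_even_iff_odd] at hi
  have := eps_odd hi
  fin_cases i <;> simp_all

abbrev L3 := Fin 3 → ℤ

/-- The product of four theta functions with first argument `z`. -/
noncomputable def PP (τ : Matrix (Fin 3) (Fin 3) ℂ) (a1 a2 a3 b1 b2 b3 : L3)
    (z0 z1 : Fin 3 → ℂ) (x y : L3) : ℂ :=
  SiegelTheta 3 τ z0 x y * (SiegelTheta 3 τ z1 (x + a1 + a2) (y + b1 + b2) *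
    (SiegelTheta 3 τ z1 (x + a1 + a3) (y + b1 + b3) *
      SiegelTheta 3 τ z1 (x + a2 + a3) (y + b2 + b3)))

noncomputable def gM (σ x : L3) (N : L3 × L3 × L3 × L3) : (Fin 3 → Fin 2) × L3 × L3 × L3 × L3 :=
  (fun i => if (N.1 i + N.2.1 i + N.2.2.1 i + N.2.2.2 i + σ i) % 2 = 0 then 0 else 1,
   fun i => (N.1 i + N.2.1 i + N.2.2.1 i + N.2.2.2 i + σ i) / 2 + x i,
   fun i => (N.1 i + N.2.1 i - N.2.2.1 i - N.2.2.2 i - σ i -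
    (N.1 i + N.2.1 i + N.2.2.1 i + N.2.2.2 i + σ i) % 2) / 2,
   fun i => (N.1 i - N.2.1 i + N.2.2.1 i - N.2.2.2 i - σ i -
    (N.1 i + N.2.1 i + N.2.2.1 i + N.2.2.2 i + σ i) % 2) / 2,
   fun i => (N.1 i - N.2.1 i - N.2.2.1 i + N.2.2.2 i - σ i -
    (N.1 i + N.2.1 i + N.2.2.1 i + N.2.2.2 i + σ i) % 2) / 2)

theorem bz_gM (σ x : L3) (N : L3 × L3 × L3 × L3) (i : Fin 3) :
    bz (gM σ x N).1 i = (N.1 i + N.2.1 i + N.2.2.1 i + N.2.2.2 i + σ i) % 2 := by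
  simp only [bz, gM]
  split_ifs with h
  · simp [h]
  · simp; omega

theorem gM_spec (σ x : L3) (N : L3 × L3 × L3 × L3) (i : Fin 3) :
    2 * N.1 i = (gM σ x N).2.1 i + (gM σ x N).2.2.1 i + (gM σ x N).2.2.2.1 i
        + (gM σ x N).2.2.2.2 i + 2 * bz (gM σ x N).1 i + σ i - x i ∧
    2 * N.2.1 i = (gM σ x N).2.1 i + (gM σ x N).2.2.1 i - (gM σ x N).2.2.2.1 i
        - (gM σ x N).2.2.2.2 i - σ i - x i ∧
    2 * N.2.2.1 i = (gM σ x N).2.1 i - (gM σ x N).2.2.1 i + (gM σ x N).2.2.2.1 i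
        - (gM σ x N).2.2.2.2 i - σ i - x i ∧
    2 * N.2.2.2 i = (gM σ x N).2.1 i - (gM σ x N).2.2.1 i - (gM σ x N).2.2.2.1 i
        + (gM σ x N).2.2.2.2 i - σ i - x i := by
  rw [bz_gM]
  simp only [gM]
  omega

theorem gM_inj (σ x : L3) : Function.Injective (gM σ x) := by
  intro N N' h
  have h1 := gM_spec σ x N
  have h2 := gM_spec σ x N'
  rw [← h] at h2
  refine Prod.ext (funext fun i => ?_) (Prod.ext (funext fun i => ?_)
    (Prod.ext (funext fun i => ?_) (funext fun i => ?_)))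
  · have := h1 i; have := h2 i; omega
  · have := h1 i; have := h2 i; omega
  · have := h1 i; have := h2 i; omega
  · have := h1 i; have := h2 i; omega

theorem gM_surj (σ x : L3) (Q : (Fin 3 → Fin 2) × L3 × L3 × L3 × L3)
    (h : ∀ i, Even (Q.2.1 i + Q.2.2.1 i + Q.2.2.2.1 i + Q.2.2.2.2 i + σ i + x i)) :
    Q ∈ Set.range (gM σ x) := by
  obtain ⟨r, M1, M2, M3, M4⟩ := Q
  refine ⟨(fun i => (M1 i + M2 i + M3 i + M4 i + 2 * bz r i + σ i - x i) / 2,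
    fun i => (M1 i + M2 i - M3 i - M4 i - σ i - x i) / 2,
    fun i => (M1 i - M2 i + M3 i - M4 i - σ i - x i) / 2,
    fun i => (M1 i - M2 i - M3 i + M4 i - σ i - x i) / 2), ?_⟩
  simp only at h
  have hb : ∀ i, bz r i = 0 ∧ r i = 0 ∨ bz r i = 1 ∧ r i = 1 := by
    intro i
    simp only [bz]
    generalize r i = t
    fin_cases t <;> simp
  simp only [gM]
  refine Prod.ext (funext fun i => ?_) (Prod.ext (funext fun i => ?_) (Prod.ext (funext fun i => ?_)
    (Prod.ext (funext fun i => ?_) (funext fun i => ?_))))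
  all_goals
    obtain ⟨k, hk⟩ := h i
    rcases hb i with ⟨h1, h2⟩ | ⟨h1, h2⟩
  · simp only [h1, h2]; rw [if_pos]; omega
  · simp only [h1, h2]; rw [if_neg]; omega
  all_goals simp only [h1]; omega

/-- exponential after the orthogonal change of variables -/
noncomputable def FF (τ : Matrix (Fin 3) (Fin 3) ℂ) (a1 a2 a3 b1 b2 b3 : L3)
    (z : Fin 3 → ℂ) (y : L3) (Q : (Fin 3 → Fin 2) × L3 × L3 × L3 × L3) : ℂ :=
  Complex.exp (Real.pi * Complex.I * (
    thE τ (fun i => (Q.2.1 i : ℂ) + (bz Q.1 i : ℂ) / 2)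
      (fun i => z i / 2 + (2 * y i + b1 i + b2 i + b3 i) / 2) +
    thE τ (fun i => (Q.2.2.1 i : ℂ) + ((bz Q.1 + a1 + a2) i : ℂ) / 2)
      (fun i => z i / 2 - (b3 i : ℂ) / 2) +
    thE τ (fun i => (Q.2.2.2.1 i : ℂ) + ((bz Q.1 + a1 + a3) i : ℂ) / 2)
      (fun i => z i / 2 - (b2 i : ℂ) / 2) +
    thE τ (fun i => (Q.2.2.2.2 i : ℂ) + ((bz Q.1 + a2 + a3) i : ℂ) / 2)
      (fun i => z i / 2 - (b1 i : ℂ) / 2)))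

theorem FF_gM (τ : Matrix (Fin 3) (Fin 3) ℂ) (a1 a2 a3 b1 b2 b3 : L3)
    (z : Fin 3 → ℂ) (x y : L3) (N : L3 × L3 × L3 × L3) :
    FF τ a1 a2 a3 b1 b2 b3 z y (gM (a1 + a2 + a3) x N) =
      thTerm τ z x y N.1 * (thTerm τ 0 (x + a1 + a2) (y + b1 + b2) N.2.1 *
        (thTerm τ 0 (x + a1 + a3) (y + b1 + b3) N.2.2.1 *
          thTerm τ 0 (x + a2 + a3) (y + b2 + b3) N.2.2.2)) := by
  have hs := gM_spec (a1 + a2 + a3) x N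
  generalize gM (a1 + a2 + a3) x N = Q at hs
  simp only [thTerm_eq]
  rw [← Complex.exp_add, ← Complex.exp_add, ← Complex.exp_add, FF]
  congr 1
  rw [← mul_add, ← mul_add, ← mul_add]
  congr 1
  have key := thE_orth τ (fun i => (Q.2.1 i : ℂ) + (bz Q.1 i : ℂ) / 2)
    (fun i => (Q.2.2.1 i : ℂ) + ((bz Q.1 + a1 + a2) i : ℂ) / 2)
    (fun i => (Q.2.2.2.1 i : ℂ) + ((bz Q.1 + a1 + a3) i : ℂ) / 2)
    (fun i => (Q.2.2.2.2 i : ℂ) + ((bz Q.1 + a2 + a3) i : ℂ) / 2)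
    (fun i => z i + (y i : ℂ) / 2)
    (fun i => (0 : Fin 3 → ℂ) i + ((y + b1 + b2) i : ℂ) / 2)
    (fun i => (0 : Fin 3 → ℂ) i + ((y + b1 + b3) i : ℂ) / 2)
    (fun i => (0 : Fin 3 → ℂ) i + ((y + b2 + b3) i : ℂ) / 2)
  have hc : ∀ i, (2 * (N.1 i : ℂ) = (Q.2.1 i : ℂ) + Q.2.2.1 i + Q.2.2.2.1 i
        + Q.2.2.2.2 i + 2 * bz Q.1 i + (a1 i + a2 i + a3 i) - x i) ∧
      (2 * (N.2.1 i : ℂ) = (Q.2.1 i : ℂ) + Q.2.2.1 i - Q.2.2.2.1 i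
        - Q.2.2.2.2 i - (a1 i + a2 i + a3 i) - x i) ∧
      (2 * (N.2.2.1 i : ℂ) = (Q.2.1 i : ℂ) - Q.2.2.1 i + Q.2.2.2.1 i
        - Q.2.2.2.2 i - (a1 i + a2 i + a3 i) - x i) ∧
      (2 * (N.2.2.2 i : ℂ) = (Q.2.1 i : ℂ) - Q.2.2.1 i - Q.2.2.2.1 i
        + Q.2.2.2.2 i - (a1 i + a2 i + a3 i) - x i) := by
    intro i
    obtain ⟨h1, h2, h3, h4⟩ := hs i
    simp only [Pi.add_apply] at h1 h2 h3 h4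
    exact ⟨by exact_mod_cast h1, by exact_mod_cast h2, by exact_mod_cast h3, by exact_mod_cast h4⟩
  rw [← add_assoc, ← add_assoc]
  convert key.symm using 1
  · congr 1
    · congr 1
      · congr 1
        · congr 1; funext i; simp only [Pi.add_apply, Pi.zero_apply]; push_cast; ring
        · congr 1; funext i; simp only [Pi.add_apply, Pi.zero_apply]; push_cast; ring
      · congr 1; funext i; simp only [Pi.add_apply, Pi.zero_apply]; push_cast; ring
    · congr 1; funext i; simp only [Pi.add_apply, Pi.zero_apply]; push_cast; ring
  · congr 1
    · congr 1
      · congr 1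
        · congr 1; funext i; simp only [Pi.add_apply]; push_cast
          linear_combination (hc i).1 / 2
        · congr 1; funext i; simp only [Pi.add_apply]; push_cast
          linear_combination (hc i).2.1 / 2
      · congr 1; funext i; simp only [Pi.add_apply]; push_cast
        linear_combination (hc i).2.2.1 / 2
    · congr 1; funext i; simp only [Pi.add_apply]; push_cast
      linear_combination (hc i).2.2.2 / 2

theorem term_rp (τ : Matrix (Fin 3) (Fin 3) ℂ) (a1 a2 a3 b1 b2 b3 : L3)
    (z : Fin 3 → ℂ) (x y : L3) (r p : Fin 3 → Fin 2) (M : L3 × L3 × L3 × L3) :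
    eps (∑ i, (bz p i + (b1 + b2 + b3) i) * x i + ∑ i, bz r i * (y i + (b1 + b2 + b3) i)) *
     (thTerm τ (fun i => z i / 2) (bz r) (bz p) M.1 *
      (thTerm τ (fun i => z i / 2) (bz r + a1 + a2) (bz p + b1 + b2) M.2.1 *
        (thTerm τ (fun i => z i / 2) (bz r + a1 + a3) (bz p + b1 + b3) M.2.2.1 *
          thTerm τ (fun i => z i / 2) (bz r + a2 + a3) (bz p + b2 + b3) M.2.2.2))) =
    eps (∑ i, (bz p i + (b1 + b2 + b3) i) *
      (M.1 i + M.2.1 i + M.2.2.1 i + M.2.2.2 i + (a1 + a2 + a3) i + x i)) *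
      FF τ a1 a2 a3 b1 b2 b3 z y (r, M) := by
  have h1 : eps (∑ i, (bz p i + (b1 + b2 + b3) i) *
      (M.1 i + M.2.1 i + M.2.2.1 i + M.2.2.2 i + (a1 + a2 + a3) i + x i)) =
      eps (∑ i, (bz p i + (b1 + b2 + b3) i) *
      (M.1 i + M.2.1 i + M.2.2.1 i + M.2.2.2 i + (a1 + a2 + a3) i + x i)
       + 2 * (∑ i, ((bz p i + (b1 + b2 + b3) i) * bz r i
        - M.1 i * (y i + (b1 + b2 + b3) i)))) := by
    rw [eps_add, eps_two_mul, mul_one]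
  rw [h1]
  simp only [thTerm_eq, FF, eps]
  simp only [← Complex.exp_add]
  congr 1
  simp only [thE, Fin.sum_univ_three, Pi.add_apply]
  push_cast
  ring

theorem riemann (τ : Matrix (Fin 3) (Fin 3) ℂ) (hτ : InSiegelUpperHalfSpace τ)
    (a1 a2 a3 b1 b2 b3 : L3) (z : Fin 3 → ℂ) (x y : L3) :
    8 * PP τ a1 a2 a3 b1 b2 b3 z 0 x y = ∑ r : Fin 3 → Fin 2, ∑ p : Fin 3 → Fin 2,
      eps (∑ i, (bz p i + (b1 + b2 + b3) i) * x i + ∑ i, bz r i * (y i + (b1 + b2 + b3) i)) *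
      PP τ a1 a2 a3 b1 b2 b3 (fun i => z i / 2) (fun i => z i / 2) (bz r) (bz p) := by
  have hsm := summable_norm_thTerm τ hτ
  -- the left side
  have hL : PP τ a1 a2 a3 b1 b2 b3 z 0 x y =
      ∑' N, FF τ a1 a2 a3 b1 b2 b3 z y (gM (a1 + a2 + a3) x N) := by
    rw [PP, siegelTheta_eq, siegelTheta_eq, siegelTheta_eq, siegelTheta_eq,
      (prod4_tsum _ _ _ _ (hsm _ _ _) (hsm _ _ _) (hsm _ _ _) (hsm _ _ _)).1]
    exact tsum_congr fun N => (FF_gM τ a1 a2 a3 b1 b2 b3 z x y N).symm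
  let K : L3 × L3 × L3 × L3 → L3 := fun M i =>
    M.1 i + M.2.1 i + M.2.2.1 i + M.2.2.2 i + (a1 + a2 + a3) i + x i
  let G : (Fin 3 → Fin 2) × L3 × L3 × L3 × L3 → ℂ := fun Q =>
    (∑ p : Fin 3 → Fin 2, eps (∑ i, (bz p i + (b1 + b2 + b3) i) * K Q.2 i)) *
      FF τ a1 a2 a3 b1 b2 b3 z y Q
  have hterm : ∀ r p : Fin 3 → Fin 2,
      HasSum (fun M => eps (∑ i, (bz p i + (b1 + b2 + b3) i) * K M i) *
        FF τ a1 a2 a3 b1 b2 b3 z y (r, M))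
      (eps (∑ i, (bz p i + (b1 + b2 + b3) i) * x i + ∑ i, bz r i * (y i + (b1 + b2 + b3) i)) *
      PP τ a1 a2 a3 b1 b2 b3 (fun i => z i / 2) (fun i => z i / 2) (bz r) (bz p)) := by
    intro r p
    obtain ⟨h1, h2⟩ := prod4_tsum _ _ _ _ (hsm (fun i => z i / 2) (bz r) (bz p))
      (hsm (fun i => z i / 2) (bz r + a1 + a2) (bz p + b1 + b2))
      (hsm (fun i => z i / 2) (bz r + a1 + a3) (bz p + b1 + b3))
      (hsm (fun i => z i / 2) (bz r + a2 + a3) (bz p + b2 + b3))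
    have h3 := (h2.hasSum).mul_left (eps (∑ i, (bz p i + (b1 + b2 + b3) i) * x i
      + ∑ i, bz r i * (y i + (b1 + b2 + b3) i)))
    rw [← h1] at h3
    simp only [term_rp] at h3
    exact h3
  have hr : ∀ r, HasSum (fun M => G (r, M)) (∑ p : Fin 3 → Fin 2,
      eps (∑ i, (bz p i + (b1 + b2 + b3) i) * x i + ∑ i, bz r i * (y i + (b1 + b2 + b3) i)) *
      PP τ a1 a2 a3 b1 b2 b3 (fun i => z i / 2) (fun i => z i / 2) (bz r) (bz p)) := by
    intro r
    have := hasSum_sum (s := Finset.univ) fun p _ => hterm r p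
    simpa only [G, Finset.sum_mul] using this
  have hGsum : Summable G := by
    rw [← (Equiv.refl _).summable_iff]
    refine (Equiv.sigmaEquivProd (Fin 3 → Fin 2) (L3 × L3 × L3 × L3)).summable_iff.mp ?_
    have hn : ∀ r, Summable (fun M => ‖G (r, M)‖) := fun r => (hr r).summable.norm
    refine Summable.of_norm ?_
    rw [summable_sigma_of_nonneg (fun _ => norm_nonneg _)]
    exact ⟨fun r => hn r, (hasSum_fintype _).summable⟩
  have hR : ∑' Q, G Q = ∑ r : Fin 3 → Fin 2, ∑ p : Fin 3 → Fin 2,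
      eps (∑ i, (bz p i + (b1 + b2 + b3) i) * x i + ∑ i, bz r i * (y i + (b1 + b2 + b3) i)) *
      PP τ a1 a2 a3 b1 b2 b3 (fun i => z i / 2) (fun i => z i / 2) (bz r) (bz p) := by
    rw [hGsum.tsum_prod' (fun r => (hr r).summable), tsum_fintype]
    exact Finset.sum_congr rfl fun r _ => (hr r).tsum_eq
  rw [← hR, ← (gM_inj (a1 + a2 + a3) x).tsum_eq, hL, ← tsum_mul_left]
  · refine tsum_congr fun N => ?_
    simp only [G]
    rw [sum_eps_even]
    intro i
    have := gM_spec (a1 + a2 + a3) x N i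
    simp only [K]
    exact ⟨N.1 i - bz (gM (a1 + a2 + a3) x N).1 i + x i, by linarith [this.1]⟩
  · intro Q hQ
    apply gM_surj
    by_contra hcon
    apply hQ
    simp only [G]
    rw [sum_eps_odd _ _ hcon, zero_mul]

theorem z2_two : (2 : ZMod 2) = 0 := by decide

theorem e_five (A B : Fin 7 → Fin 3 → ZMod 2) (h1 : ∀ k, ∑ i, A k i * B k i = 1)
    (h3 : ∀ a b c, a ≠ b → a ≠ c → b ≠ c →
      ∑ i, (A a i + A b i + A c i) * (B a i + B b i + B c i) = 0)
    (a b c d f : Fin 7) (hab : a ≠ b) (hac : a ≠ c) (had : a ≠ d) (haf : a ≠ f) (hbc : b ≠ c)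
    (hbd : b ≠ d) (hbf : b ≠ f) (hcd : c ≠ d) (hcf : c ≠ f) (hdf : d ≠ f) :
    ∑ i, (A a i + A b i + A c i + A d i + A f i) * (B a i + B b i + B c i + B d i + B f i) = 1 := by
  have e1 := h3 a b c hab hac hbc
  have e2 := h3 a b d hab had hbd
  have e3 := h3 a b f hab haf hbf
  have e4 := h3 a c d hac had hcd
  have e5 := h3 a c f hac haf hcf
  have e6 := h3 a d f had haf hdf
  have e7 := h3 b c d hbc hbd hcd
  have e8 := h3 b c f hbc hbf hcf
  have e9 := h3 b d f hbd hbf hdf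
  have e10 := h3 c d f hcd hcf hdf
  have f1 := h1 a
  have f2 := h1 b
  have f3 := h1 c
  have f4 := h1 d
  have f5 := h1 f
  simp only [Fin.sum_univ_three] at *
  linear_combination e1 + e2 + e3 + e4 + e5 + e6 + e7 + e8 + e9 + e10 + f1 + f2 + f3 + f4 + f5 +
    (2 - ((A a 0 + A b 0 + A c 0 + A d 0 + A f 0) * (B a 0 + B b 0 + B c 0 + B d 0 + B f 0)
    + (A a 1 + A b 1 + A c 1 + A d 1 + A f 1) * (B a 1 + B b 1 + B c 1 + B d 1 + B f 1)
    + (A a 2 + A b 2 + A c 2 + A d 2 + A f 2) * (B a 2 + B b 2 + B c 2 + B d 2 + B f 2))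
    - 2 * ((A a 0 * B a 0 + A a 1 * B a 1 + A a 2 * B a 2)
    + (A b 0 * B b 0 + A b 1 * B b 1 + A b 2 * B b 2)
    + (A c 0 * B c 0 + A c 1 * B c 1 + A c 2 * B c 2)
    + (A d 0 * B d 0 + A d 1 * B d 1 + A d 2 * B d 2)
    + (A f 0 * B f 0 + A f 1 * B f 1 + A f 2 * B f 2))) * z2_two

theorem gram (A B : Fin 7 → Fin 3 → ZMod 2) (h1 : ∀ k, ∑ i, A k i * B k i = 1)
    (h3 : ∀ a b c, a ≠ b → a ≠ c → b ≠ c →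
      ∑ i, (A a i + A b i + A c i) * (B a i + B b i + B c i) = 0) (a b : Fin 6) :
    ∑ i, ((A a.castSucc i + A 6 i) * (B b.castSucc i + B 6 i)
      + (B a.castSucc i + B 6 i) * (A b.castSucc i + A 6 i)) = if a = b then 0 else 1 := by
  split_ifs with hab
  · subst hab
    refine Finset.sum_eq_zero fun i _ => ?_
    linear_combination ((A a.castSucc i + A 6 i) * (B a.castSucc i + B 6 i)) * z2_two
  · have n1 : a.castSucc ≠ b.castSucc := fun h => hab (Fin.castSucc_injective _ h)
    have n2 : ∀ a : Fin 6, a.castSucc ≠ (6 : Fin 7) := by decide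
    have e1 := h3 _ _ _ n1 (n2 a) (n2 b)
    have f1 := h1 a.castSucc
    have f2 := h1 b.castSucc
    have f3 := h1 6
    simp only [Fin.sum_univ_three] at *
    linear_combination e1 - f1 - f2 + f3 +
      (-1 + (A 6 0 * B 6 0 + A 6 1 * B 6 1 + A 6 2 * B 6 2) * 0) * z2_two

theorem expand (A B : Fin 7 → Fin 3 → ZMod 2) (h1 : ∀ k, ∑ i, A k i * B k i = 1)
    (h3 : ∀ a b c, a ≠ b → a ≠ c → b ≠ c →
      ∑ i, (A a i + A b i + A c i) * (B a i + B b i + B c i) = 0) (r p : Fin 3 → ZMod 2) :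
    ∃ t : Fin 6 → ZMod 2,
      (∀ a, t a = ∑ i, (r i * (B a.castSucc i + B 6 i) + p i * (A a.castSucc i + A 6 i))) ∧
      (∀ i, r i = ∑ b : Fin 6, (∑ a, t a * (if a = b then 0 else 1)) * (A b.castSucc i + A 6 i)) ∧
      (∀ i, p i = ∑ b : Fin 6, (∑ a, t a * (if a = b then 0 else 1)) * (B b.castSucc i + B 6 i)) := by
  let V : Matrix (Fin 6) (Fin 3 ⊕ Fin 3) (ZMod 2) := Matrix.of fun a =>
    Sum.elim (fun i => A a.castSucc i + A 6 i) (fun i => B a.castSucc i + B 6 i)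
  let C : Matrix (Fin 3 ⊕ Fin 3) (Fin 6) (ZMod 2) := Matrix.of fun s a =>
    Sum.elim (fun i => B a.castSucc i + B 6 i) (fun i => A a.castSucc i + A 6 i) s
  let G : Matrix (Fin 6) (Fin 6) (ZMod 2) := Matrix.of fun a b => if a = b then 0 else 1
  have hVC : V * C = G := by
    ext a b
    rw [Matrix.mul_apply, Fintype.sum_sum_type]
    have := gram A B h1 h3 a b
    rw [Finset.sum_add_distrib] at this
    simpa [V, C, G] using this
  have hGG : G * G = 1 := by
    have : ∀ a b, (G * G) a b = (1 : Matrix (Fin 6) (Fin 6) (ZMod 2)) a b := by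
      simp only [Matrix.mul_apply, G, Matrix.of_apply, Matrix.one_apply]
      decide
    ext a b; exact this a b
  have hCG : C * (G * V) = 1 := by
    refine (Matrix.mul_eq_one_comm_of_equiv
      (finSumFinEquiv : Fin 3 ⊕ Fin 3 ≃ Fin (3 + 3))).mpr ?_
    rw [Matrix.mul_assoc, hVC, hGG]
  let w : Fin 3 ⊕ Fin 3 → ZMod 2 := Sum.elim r p
  have hw : Matrix.vecMul (Matrix.vecMul (Matrix.vecMul w C) G) V = w := by
    rw [Matrix.vecMul_vecMul, Matrix.vecMul_vecMul, hCG, Matrix.vecMul_one]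
  refine ⟨Matrix.vecMul w C, fun a => ?_, fun i => ?_, fun i => ?_⟩
  · simp [Matrix.vecMul, dotProduct, w, C, Finset.sum_add_distrib]
  · have := congrFun hw (Sum.inl i)
    rw [show w (Sum.inl i) = r i from rfl] at this
    rw [← this]
    rfl
  · have := congrFun hw (Sum.inr i)
    rw [show w (Sum.inr i) = p i from rfl] at this
    rw [← this]
    rfl

/-- Two of the four characteristics are odd. -/
def TwoOdd (e0 e1 e2 e3 : ZMod 2) : Prop :=
  (e0 = 1 ∧ e1 = 1) ∨ (e0 = 1 ∧ e2 = 1) ∨ (e0 = 1 ∧ e3 = 1) ∨ (e1 = 1 ∧ e2 = 1) ∨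
    (e1 = 1 ∧ e3 = 1) ∨ (e2 = 1 ∧ e3 = 1)

theorem key_two_odd (A B : Fin 7 → Fin 3 → ZMod 2) (h1 : ∀ k, ∑ i, A k i * B k i = 1)
    (h3 : ∀ a b c, a ≠ b → a ≠ c → b ≠ c →
      ∑ i, (A a i + A b i + A c i) * (B a i + B b i + B c i) = 0) (r p : Fin 3 → ZMod 2)
    (hk : ∀ k : Fin 3, ∑ i, ((p i + B 6 i) * (A k.succ.castSucc.castSucc.castSucc i - A 0 i)
      + (r i + A 6 i) * (B k.succ.castSucc.castSucc.castSucc i - B 0 i)) = 0) :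
    TwoOdd (∑ i, r i * p i) (∑ i, (r i + A 4 i + A 5 i) * (p i + B 4 i + B 5 i))
      (∑ i, (r i + A 4 i + A 6 i) * (p i + B 4 i + B 6 i))
      (∑ i, (r i + A 5 i + A 6 i) * (p i + B 5 i + B 6 i)) := by
  obtain ⟨t, ht, hr, hp⟩ := expand A B h1 h3 (fun i => r i + A 6 i) (fun i => p i + B 6 i)
  have q1 : t 1 = t 0 := by
    have := hk 0
    have a0 := ht 0
    have a1 := ht 1
    simp only [Fin.sum_univ_three, Fin.isValue] at this a0 a1
    simp at this a0 a1
    linear_combination a1 - a0 + this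
  have q2 : t 2 = t 0 := by
    have := hk 1
    have a0 := ht 0
    have a1 := ht 2
    simp only [Fin.sum_univ_three, Fin.isValue] at this a0 a1
    simp at this a0 a1
    linear_combination a1 - a0 + this
  have q3 : t 3 = t 0 := by
    have := hk 2
    have a0 := ht 0
    have a1 := ht 3
    simp only [Fin.sum_univ_three, Fin.isValue] at this a0 a1
    simp at this a0 a1
    linear_combination a1 - a0 + this
  have z01 : ∀ u : ZMod 2, u = 0 ∨ u = 1 := by decide
  obtain ⟨u, hu⟩ : ∃ u, u = t 0 + t 4 + t 5 := ⟨_, rfl⟩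
  have hod : ∀ k : Fin 7, (0 ≠ k ∧ 1 ≠ k ∧ 2 ≠ k ∧ 3 ≠ k) →
      ∑ i, (A k i + u * (A 0 i + A 1 i + A 2 i + A 3 i)) *
        (B k i + u * (B 0 i + B 1 i + B 2 i + B 3 i)) = 1 := by
    intro k hk'
    rcases z01 u with h | h
    · rw [← h1 k, h]; simp
    · rw [← e_five A B h1 h3 0 1 2 3 k (by decide) (by decide) (by decide) hk'.1 (by decide)
        (by decide) hk'.2.1 (by decide) hk'.2.2.1 hk'.2.2.2, h]
      refine Finset.sum_congr rfl fun i _ => ?_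
      ring
  have o4 := hod 4 (by decide)
  have o5 := hod 5 (by decide)
  have hr' : ∀ i, r i = A 6 i + u * (A 0 i + A 1 i + A 2 i + A 3 i) + t 5 * (A 4 i + A 6 i)
      + t 4 * (A 5 i + A 6 i) := by
    intro i
    have := hr i
    simp [Fin.sum_univ_succ, q1, q2, q3] at this
    rw [hu]
    linear_combination this + (-A 6 i + t 0 * (A 0 i + A 1 i + A 2 i + A 3 i) +
      2 * (t 0 + t 4 + t 5 + 2 * t 0) * A 6 i + 2 * t 0 * (A 4 i + A 5 i + 2 * A 6 i)) * z2_two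
  have hp' : ∀ i, p i = B 6 i + u * (B 0 i + B 1 i + B 2 i + B 3 i) + t 5 * (B 4 i + B 6 i)
      + t 4 * (B 5 i + B 6 i) := by
    intro i
    have := hp i
    simp [Fin.sum_univ_succ, q1, q2, q3] at this
    rw [hu]
    linear_combination this + (-B 6 i + t 0 * (B 0 i + B 1 i + B 2 i + B 3 i) +
      2 * (t 0 + t 4 + t 5 + 2 * t 0) * B 6 i + 2 * t 0 * (B 4 i + B 5 i + 2 * B 6 i)) * z2_two
  rcases z01 (t 5) with hb | hb <;> rcases z01 (t 4) with hg | hg <;> rw [hb, hg] at hr' hp'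
  · right; right; right; right; right
    constructor
    · rw [← o4]
      refine Finset.sum_congr rfl fun i _ => congrArg₂ _ ?_ ?_
      · linear_combination hr' i + A 6 i * z2_two
      · linear_combination hp' i + B 6 i * z2_two
    · rw [← o5]
      refine Finset.sum_congr rfl fun i _ => congrArg₂ _ ?_ ?_
      · linear_combination hr' i + A 6 i * z2_two
      · linear_combination hp' i + B 6 i * z2_two
  · left
    constructor
    · rw [← o5]
      refine Finset.sum_congr rfl fun i _ => congrArg₂ _ ?_ ?_
      · linear_combination hr' i + A 6 i * z2_two
      · linear_combination hp' i + B 6 i * z2_two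
    · rw [← o4]
      refine Finset.sum_congr rfl fun i _ => congrArg₂ _ ?_ ?_
      · linear_combination hr' i + (A 6 i + A 5 i) * z2_two
      · linear_combination hp' i + (B 6 i + B 5 i) * z2_two
  · left
    constructor
    · rw [← o4]
      refine Finset.sum_congr rfl fun i _ => congrArg₂ _ ?_ ?_
      · linear_combination hr' i + A 6 i * z2_two
      · linear_combination hp' i + B 6 i * z2_two
    · rw [← o5]
      refine Finset.sum_congr rfl fun i _ => congrArg₂ _ ?_ ?_
      · linear_combination hr' i + (A 6 i + A 4 i) * z2_two
      · linear_combination hp' i + (B 6 i + B 4 i) * z2_two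
  · right; right; right; right; right
    constructor
    · rw [← o5]
      refine Finset.sum_congr rfl fun i _ => congrArg₂ _ ?_ ?_
      · linear_combination hr' i + (2 * A 6 i + A 4 i) * z2_two
      · linear_combination hp' i + (2 * B 6 i + B 4 i) * z2_two
    · rw [← o4]
      refine Finset.sum_congr rfl fun i _ => congrArg₂ _ ?_ ?_
      · linear_combination hr' i + (2 * A 6 i + A 5 i) * z2_two
      · linear_combination hp' i + (2 * B 6 i + B 5 i) * z2_two

theorem fderiv_prod4 {f1 f2 f3 f4 : (Fin 3 → ℂ) → ℂ} (d1 : DifferentiableAt ℂ f1 0)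
    (d2 : DifferentiableAt ℂ f2 0) (d3 : DifferentiableAt ℂ f3 0) (d4 : DifferentiableAt ℂ f4 0)
    (h : (f1 0 = 0 ∧ f2 0 = 0) ∨ (f1 0 = 0 ∧ f3 0 = 0) ∨ (f1 0 = 0 ∧ f4 0 = 0) ∨
      (f2 0 = 0 ∧ f3 0 = 0) ∨ (f2 0 = 0 ∧ f4 0 = 0) ∨ (f3 0 = 0 ∧ f4 0 = 0)) :
    HasFDerivAt (fun z => f1 z * (f2 z * (f3 z * f4 z))) (0 : (Fin 3 → ℂ) →L[ℂ] ℂ) 0 := by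
  have := d1.hasFDerivAt.mul (d2.hasFDerivAt.mul (d3.hasFDerivAt.mul d4.hasFDerivAt))
  refine this.congr_fderiv ?_
  ext v
  rcases h with ⟨h, h'⟩ | ⟨h, h'⟩ | ⟨h, h'⟩ | ⟨h, h'⟩ | ⟨h, h'⟩ | ⟨h, h'⟩ <;>
    simp [add_apply, smul_apply, h, h']

theorem odd_cast (a b : L3) (h : ∑ i, (a i : ZMod 2) * (b i : ZMod 2) = 1) :
    Odd (∑ i, a i * b i) := by
  rw [← ZMod.intCast_eq_one_iff_odd]
  push_cast
  exact h

theorem differentiableAt_half (τ : Matrix (Fin 3) (Fin 3) ℂ) (hτ : InSiegelUpperHalfSpace τ)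
    (a b : Fin 3 → ℤ) :
    DifferentiableAt ℂ (fun z : Fin 3 → ℂ => SiegelTheta 3 τ (fun i => z i / 2) a b) 0 := by
  have h := differentiableAt_theta τ hτ a b
  have e : (0 : Fin 3 → ℂ) = (fun z : Fin 3 → ℂ => fun i => z i / 2) 0 := by
    funext i; simp
  rw [e] at h
  exact h.comp (0 : Fin 3 → ℂ) (f := fun z : Fin 3 → ℂ => fun i => z i / 2) (by fun_prop)

/-- Derivative of the product of the four theta functions at `z / 2`. -/
theorem hasFDerivAt_PP_half (τ : Matrix (Fin 3) (Fin 3) ℂ) (hτ : InSiegelUpperHalfSpace τ)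
    (a1 a2 a3 b1 b2 b3 x y : L3) :
    DifferentiableAt ℂ (fun z : Fin 3 → ℂ => PP τ a1 a2 a3 b1 b2 b3 (fun i => z i / 2)
      (fun i => z i / 2) x y) 0 := by
  unfold PP
  exact (differentiableAt_half τ hτ _ _).mul ((differentiableAt_half τ hτ _ _).mul
    ((differentiableAt_half τ hτ _ _).mul (differentiableAt_half τ hτ _ _)))

theorem hasFDerivAt_PP_zero (τ : Matrix (Fin 3) (Fin 3) ℂ) (hτ : InSiegelUpperHalfSpace τ)
    (a1 a2 a3 b1 b2 b3 x y : L3)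
    (h : TwoOdd (∑ i, (x i : ZMod 2) * y i)
      (∑ i, ((x i : ZMod 2) + a1 i + a2 i) * (y i + b1 i + b2 i))
      (∑ i, ((x i : ZMod 2) + a1 i + a3 i) * (y i + b1 i + b3 i))
      (∑ i, ((x i : ZMod 2) + a2 i + a3 i) * (y i + b2 i + b3 i))) :
    fderiv ℂ (fun z : Fin 3 → ℂ => PP τ a1 a2 a3 b1 b2 b3 (fun i => z i / 2)
      (fun i => z i / 2) x y) 0 = 0 := by
  have key : ∀ a b : L3, ∑ i, (a i : ZMod 2) * (b i : ZMod 2) = 1 →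
      SiegelTheta 3 τ (fun i => (0 : Fin 3 → ℂ) i / 2) a b = 0 := by
    intro a b hab
    rw [show (fun i => (0 : Fin 3 → ℂ) i / 2) = 0 by funext i; simp]
    exact theta_odd_zero τ a b (odd_cast a b hab)
  unfold PP
  refine (fderiv_prod4 (differentiableAt_half τ hτ _ _) (differentiableAt_half τ hτ _ _)
    (differentiableAt_half τ hτ _ _) (differentiableAt_half τ hτ _ _) ?_).fderiv
  have k0 := key x y
  have k1 := key (x + a1 + a2) (y + b1 + b2)
  have k2 := key (x + a1 + a3) (y + b1 + b3)
  have k3 := key (x + a2 + a3) (y + b2 + b3)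
  simp only [Pi.add_apply, Int.cast_add] at k1 k2 k3
  unfold TwoOdd at h
  rcases h with ⟨h, h'⟩ | ⟨h, h'⟩ | ⟨h, h'⟩ | ⟨h, h'⟩ | ⟨h, h'⟩ | ⟨h, h'⟩
  · exact Or.inl ⟨k0 h, k1 h'⟩
  · exact Or.inr (Or.inl ⟨k0 h, k2 h'⟩)
  · exact Or.inr (Or.inr (Or.inl ⟨k0 h, k3 h'⟩))
  · exact Or.inr (Or.inr (Or.inr (Or.inl ⟨k1 h, k2 h'⟩)))
  · exact Or.inr (Or.inr (Or.inr (Or.inr (Or.inl ⟨k1 h, k3 h'⟩))))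
  · exact Or.inr (Or.inr (Or.inr (Or.inr (Or.inr ⟨k2 h, k3 h'⟩))))

theorem fderiv_PP (τ : Matrix (Fin 3) (Fin 3) ℂ) (hτ : InSiegelUpperHalfSpace τ)
    (a1 a2 a3 b1 b2 b3 x y : L3) :
    HasFDerivAt (fun z : Fin 3 → ℂ => PP τ a1 a2 a3 b1 b2 b3 z 0 x y)
      ((SiegelTheta 3 τ 0 (x + a1 + a2) (y + b1 + b2) *
    (SiegelTheta 3 τ 0 (x + a1 + a3) (y + b1 + b3) *
      SiegelTheta 3 τ 0 (x + a2 + a3) (y + b2 + b3))) •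
        fderiv ℂ (fun z : Fin 3 → ℂ => SiegelTheta 3 τ z x y) 0) 0 := by
  unfold PP
  exact (differentiableAt_theta τ hτ x y).hasFDerivAt.mul_const _

/-- the eight points of the affine span -/
def xe (X : Fin 7 → L3) (ε : Fin 3 → Fin 2) : L3 := fun i =>
  X 0 i + (bz ε 0 * (X 1 i - X 0 i) + bz ε 1 * (X 2 i - X 0 i) + bz ε 2 * (X 3 i - X 0 i))

noncomputable def cst (τ : Matrix (Fin 3) (Fin 3) ℂ) (X Y : Fin 7 → L3) (x y : L3) : ℂ :=
  (SiegelTheta 3 τ 0 (x + X 4 + X 5) (y + Y 4 + Y 5) *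
    (SiegelTheta 3 τ 0 (x + X 4 + X 6) (y + Y 4 + Y 6) *
      SiegelTheta 3 τ 0 (x + X 5 + X 6) (y + Y 5 + Y 6)))

noncomputable def sgn (X Y : Fin 7 → L3) (x y : L3) : ℂ :=
  eps (∑ i, ((Y 4 i + Y 5 i) * x i + X 6 i * y i))

theorem eight_term (τ : Matrix (Fin 3) (Fin 3) ℂ) (hτ : InSiegelUpperHalfSpace τ)
    (X Y : Fin 7 → L3) (h1 : ∀ k, Odd (∑ i, X k i * Y k i))
    (h3 : ∀ a b c : Fin 7, a ≠ b → a ≠ c → b ≠ c →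
      Even (∑ i, (X a i + X b i + X c i) * (Y a i + Y b i + Y c i))) (l : Fin 3) :
    ∑ ε : Fin 3 → Fin 2, sgn X Y (xe X ε) (xe Y ε) *
      (thetaGrad 3 τ (xe X ε) (xe Y ε) l * cst τ X Y (xe X ε) (xe Y ε)) = 0 := by
  have H1 : ∀ k, ∑ i, (X k i : ZMod 2) * (Y k i : ZMod 2) = 1 := by
    intro k
    have := (ZMod.intCast_eq_one_iff_odd).mpr (h1 k)
    push_cast at this; exact this
  have H3 : ∀ a b c : Fin 7, a ≠ b → a ≠ c → b ≠ c →
      ∑ i, ((X a i : ZMod 2) + X b i + X c i) * ((Y a i : ZMod 2) + Y b i + Y c i) = 0 := by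
    intro a b c hab hac hbc
    have := (ZMod.intCast_eq_zero_iff_even).mpr (h3 a b c hab hac hbc)
    push_cast at this; exact this
  let P := fun (ε : Fin 3 → Fin 2) (z : Fin 3 → ℂ) =>
    PP τ (X 4) (X 5) (X 6) (Y 4) (Y 5) (Y 6) z 0 (xe X ε) (xe Y ε)
  let Q := fun (r p : Fin 3 → Fin 2) (z : Fin 3 → ℂ) =>
    PP τ (X 4) (X 5) (X 6) (Y 4) (Y 5) (Y 6) (fun i => z i / 2) (fun i => z i / 2) (bz r) (bz p)
  let k := fun (r p : Fin 3 → Fin 2) (j : Fin 3) => ∑ i,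
    ((bz p i + Y 6 i) * (X j.succ.castSucc.castSucc.castSucc i - X 0 i)
      + (bz r i + X 6 i) * (Y j.succ.castSucc.castSucc.castSucc i - Y 0 i))
  let c0 := fun (r p : Fin 3 → Fin 2) => eps (∑ i, ((bz p i + Y 6 i) * X 0 i
      + (bz r i + X 6 i) * Y 0 i + bz r i * (Y 4 i + Y 5 i + Y 6 i)))
  have hcoef : ∀ r p ε, sgn X Y (xe X ε) (xe Y ε) *
      eps (∑ i, (bz p i + (Y 4 + Y 5 + Y 6) i) * xe X ε i
        + ∑ i, bz r i * (xe Y ε i + (Y 4 + Y 5 + Y 6) i)) =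
      c0 r p * eps (∑ j, (bz ε j + (0 : L3) j) * k r p j) := by
    intro r p ε
    simp only [sgn, c0]
    rw [← eps_add, ← eps_add]
    apply eps_congr
    refine ⟨∑ i, (Y 4 i + Y 5 i) * xe X ε i, ?_⟩
    simp only [k, xe, Fin.sum_univ_three, Pi.add_apply, Pi.zero_apply]
    simp
    ring
  have hfun : (fun z => ∑ ε, (8 * sgn X Y (xe X ε) (xe Y ε)) * P ε z) =
      fun z => ∑ r : Fin 3 → Fin 2, ∑ p : Fin 3 → Fin 2,
        (c0 r p * ∑ ε : Fin 3 → Fin 2, eps (∑ j, (bz ε j + (0 : L3) j) * k r p j)) * Q r p z := by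
    funext z
    have : ∀ ε, (8 * sgn X Y (xe X ε) (xe Y ε)) * P ε z =
        ∑ r : Fin 3 → Fin 2, ∑ p : Fin 3 → Fin 2,
          (c0 r p * eps (∑ j, (bz ε j + (0 : L3) j) * k r p j)) * Q r p z := by
      intro ε
      rw [mul_comm (8 : ℂ), mul_assoc]
      simp only [P]
      rw [riemann τ hτ, Finset.mul_sum]
      refine Finset.sum_congr rfl fun r _ => ?_
      rw [Finset.mul_sum]
      refine Finset.sum_congr rfl fun p _ => ?_
      rw [← hcoef, mul_assoc]
    simp only [this]
    rw [Finset.sum_comm]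
    refine Finset.sum_congr rfl fun r _ => ?_
    rw [Finset.sum_comm]
    refine Finset.sum_congr rfl fun p _ => ?_
    rw [Finset.mul_sum, Finset.sum_mul]
  have hQ : ∀ r p, HasFDerivAt (fun z =>
      (c0 r p * ∑ ε : Fin 3 → Fin 2, eps (∑ j, (bz ε j + (0 : L3) j) * k r p j)) * Q r p z)
      (0 : (Fin 3 → ℂ) →L[ℂ] ℂ) 0 := by
    intro r p
    by_cases hk : ∀ j, Even (k r p j)
    · have h0 : fderiv ℂ (Q r p) 0 = 0 := by
        apply hasFDerivAt_PP_zero τ hτ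
        apply key_two_odd (fun a i => (X a i : ZMod 2)) (fun a i => (Y a i : ZMod 2)) H1 H3
        intro j
        have := (ZMod.intCast_eq_zero_iff_even).mpr (hk j)
        simp only [k] at this
        push_cast at this
        exact this
      have hd : HasFDerivAt (Q r p) (fderiv ℂ (Q r p) 0) 0 :=
        (hasFDerivAt_PP_half τ hτ _ _ _ _ _ _ _ _).hasFDerivAt
      rw [h0] at hd
      refine (hd.const_mul
        (c0 r p * ∑ ε : Fin 3 → Fin 2, eps (∑ j, (bz ε j + (0 : L3) j) * k r p j))).congr_fderiv ?_
      refine ContinuousLinearMap.ext fun v => ?_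
      rw [smul_apply]
      exact mul_zero _
    · rw [sum_eps_odd _ _ hk]
      simpa using hasFDerivAt_const (0 : ℂ) (0 : Fin 3 → ℂ)
  have hR : HasFDerivAt (fun z => ∑ ε, (8 * sgn X Y (xe X ε) (xe Y ε)) * P ε z)
      (0 : (Fin 3 → ℂ) →L[ℂ] ℂ) 0 := by
    rw [hfun]
    have := HasFDerivAt.fun_sum (u := Finset.univ) fun r (_ : r ∈ Finset.univ) =>
      HasFDerivAt.fun_sum (u := Finset.univ) fun p (_ : p ∈ Finset.univ) => hQ r p
    simpa using this
  have hL := HasFDerivAt.fun_sum (u := Finset.univ) fun ε (_ : ε ∈ Finset.univ) =>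
    (fderiv_PP τ hτ (X 4) (X 5) (X 6) (Y 4) (Y 5) (Y 6) (xe X ε) (xe Y ε)).const_mul
      (8 * sgn X Y (xe X ε) (xe Y ε))
  have heq := congrArg (fun L : (Fin 3 → ℂ) →L[ℂ] ℂ => L (Pi.single l 1)) (hL.unique hR)
  simp only [sum_apply, smul_apply, smul_eq_mul, zero_apply] at heq
  have h8 : (8 : ℂ) * ∑ ε : Fin 3 → Fin 2, sgn X Y (xe X ε) (xe Y ε) *
      (thetaGrad 3 τ (xe X ε) (xe Y ε) l * cst τ X Y (xe X ε) (xe Y ε)) = 0 := by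
    rw [← heq, Finset.mul_sum]
    refine Finset.sum_congr rfl fun ε _ => ?_
    simp only [thetaGrad, cst]
    ring
  simpa using h8

theorem cst_zero (τ : Matrix (Fin 3) (Fin 3) ℂ) (X Y : Fin 7 → L3) (x y : L3)
    (h : ∑ i, ((x i : ZMod 2) + X 4 i + X 5 i) * ((y i : ZMod 2) + Y 4 i + Y 5 i) = 1) :
    cst τ X Y x y = 0 := by
  unfold cst
  rw [theta_odd_zero τ (x + X 4 + X 5) (y + Y 4 + Y 5), zero_mul]
  apply odd_cast
  simpa using h

theorem four_term (τ : Matrix (Fin 3) (Fin 3) ℂ) (hτ : InSiegelUpperHalfSpace τ)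
    (X Y : Fin 7 → L3) (h1 : ∀ k, Odd (∑ i, X k i * Y k i))
    (h3 : ∀ a b c : Fin 7, a ≠ b → a ≠ c → b ≠ c →
      Even (∑ i, (X a i + X b i + X c i) * (Y a i + Y b i + Y c i))) (l : Fin 3) :
    sgn X Y (X 0) (Y 0) * (thetaGrad 3 τ (X 0) (Y 0) l * cst τ X Y (X 0) (Y 0)) +
    sgn X Y (X 1) (Y 1) * (thetaGrad 3 τ (X 1) (Y 1) l * cst τ X Y (X 1) (Y 1)) +
    sgn X Y (X 2) (Y 2) * (thetaGrad 3 τ (X 2) (Y 2) l * cst τ X Y (X 2) (Y 2)) +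
    sgn X Y (X 3) (Y 3) * (thetaGrad 3 τ (X 3) (Y 3) l * cst τ X Y (X 3) (Y 3)) = 0 := by
  have H1 : ∀ k, ∑ i, (X k i : ZMod 2) * (Y k i : ZMod 2) = 1 := by
    intro k
    have := (ZMod.intCast_eq_one_iff_odd).mpr (h1 k)
    push_cast at this; exact this
  have H3 : ∀ a b c : Fin 7, a ≠ b → a ≠ c → b ≠ c →
      ∑ i, ((X a i : ZMod 2) + X b i + X c i) * ((Y a i : ZMod 2) + Y b i + Y c i) = 0 := by
    intro a b c hab hac hbc
    have := (ZMod.intCast_eq_zero_iff_even).mpr (h3 a b c hab hac hbc)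
    push_cast at this; exact this
  have h5 := e_five (fun a i => (X a i : ZMod 2)) (fun a i => (Y a i : ZMod 2)) H1 H3
  have E := eight_term τ hτ X Y h1 h3 l
  rw [sum_bits] at E
  simp only [Fin.sum_univ_two] at E
  have x000 : ∀ Z : Fin 7 → L3, xe Z ![0, 0, 0] = Z 0 := by
    intro Z; funext i; simp [xe, bz]
  have x100 : ∀ Z : Fin 7 → L3, xe Z ![1, 0, 0] = Z 1 := by
    intro Z; funext i; simp [xe, bz]
  have x010 : ∀ Z : Fin 7 → L3, xe Z ![0, 1, 0] = Z 2 := by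
    intro Z; funext i; simp [xe, bz]
  have x001 : ∀ Z : Fin 7 → L3, xe Z ![0, 0, 1] = Z 3 := by
    intro Z; funext i; simp [xe, bz]
  have c110 : cst τ X Y (xe X ![1, 1, 0]) (xe Y ![1, 1, 0]) = 0 := by
    apply cst_zero
    rw [← h5 0 1 2 4 5 (by decide) (by decide) (by decide) (by decide) (by decide)
        (by decide) (by decide) (by decide) (by decide) (by decide)]
    refine Finset.sum_congr rfl fun i _ => congrArg₂ _ ?_ ?_
    · simp [xe, bz]; linear_combination -(X 0 i : ZMod 2) * z2_two
    · simp [xe, bz]; linear_combination -(Y 0 i : ZMod 2) * z2_two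
  have c101 : cst τ X Y (xe X ![1, 0, 1]) (xe Y ![1, 0, 1]) = 0 := by
    apply cst_zero
    rw [← h5 0 1 3 4 5 (by decide) (by decide) (by decide) (by decide) (by decide)
        (by decide) (by decide) (by decide) (by decide) (by decide)]
    refine Finset.sum_congr rfl fun i _ => congrArg₂ _ ?_ ?_
    · simp [xe, bz]; linear_combination -(X 0 i : ZMod 2) * z2_two
    · simp [xe, bz]; linear_combination -(Y 0 i : ZMod 2) * z2_two
  have c011 : cst τ X Y (xe X ![0, 1, 1]) (xe Y ![0, 1, 1]) = 0 := by
    apply cst_zero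
    rw [← h5 0 2 3 4 5 (by decide) (by decide) (by decide) (by decide) (by decide)
        (by decide) (by decide) (by decide) (by decide) (by decide)]
    refine Finset.sum_congr rfl fun i _ => congrArg₂ _ ?_ ?_
    · simp [xe, bz]; linear_combination -(X 0 i : ZMod 2) * z2_two
    · simp [xe, bz]; linear_combination -(Y 0 i : ZMod 2) * z2_two
  have c111 : cst τ X Y (xe X ![1, 1, 1]) (xe Y ![1, 1, 1]) = 0 := by
    apply cst_zero
    rw [← h5 1 2 3 4 5 (by decide) (by decide) (by decide) (by decide) (by decide)
        (by decide) (by decide) (by decide) (by decide) (by decide)]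
    refine Finset.sum_congr rfl fun i _ => congrArg₂ _ ?_ ?_
    · simp [xe, bz]; linear_combination -(X 0 i : ZMod 2) * z2_two
    · simp [xe, bz]; linear_combination -(Y 0 i : ZMod 2) * z2_two
  rw [c110, c101, c011, c111, x000, x000, x100, x100, x010, x010, x001, x001] at E
  linear_combination E


/-- sign weight attached to `σ` and an index `k` -/
noncomputable def sw (m' m'' : Fin 7 → Fin 3 → ℤ) (f r s k : Fin 7) : ℂ :=
  eps (∑ t, ((m'' f t + m'' r t) * m' k t + m' s t * m'' k t))

noncomputable def cw (τ : Matrix (Fin 3) (Fin 3) ℂ) (m' m'' : Fin 7 → Fin 3 → ℤ)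
    (f r s k : Fin 7) : ℂ :=
  tripleThetaConst τ m' m'' f r k *
    (tripleThetaConst τ m' m'' f s k * tripleThetaConst τ m' m'' r s k)

theorem triple_eq (τ : Matrix (Fin 3) (Fin 3) ℂ) (m' m'' : Fin 7 → Fin 3 → ℤ) (f r k : Fin 7) :
    SiegelTheta 3 τ 0 (m' k + m' f + m' r) (m'' k + m'' f + m'' r) =
      tripleThetaConst τ m' m'' f r k := by
  unfold tripleThetaConst
  congr 1 <;> funext i <;> simp only [Pi.add_apply] <;> ring

theorem line_rel (τ : Matrix (Fin 3) (Fin 3) ℂ) (hτ : InSiegelUpperHalfSpace τ)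
    (m' m'' : Fin 7 → Fin 3 → ℤ) (hA : IsAronholdChar m' m'') (a : Fin 3 → Fin 3 → ℂ)
    (A : Matrix (Fin 3) (Fin 3) ℂ) (h : Fin 7 → ℂ) (hh : ∀ k, h k ≠ 0)
    (hL : ∀ k l, lineCoeffs a k l = h k * ∑ j, thetaGrad 3 τ (m' k) (m'' k) j * A j l)
    (p f r s : Fin 7) (hi : Function.Injective ![0, 1, 2, p, f, r, s]) (l : Fin 3) :
    sw m' m'' f r s 0 * cw τ m' m'' f r s 0 * (h 0)⁻¹ * lineCoeffs a 0 l +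
    sw m' m'' f r s 1 * cw τ m' m'' f r s 1 * (h 1)⁻¹ * lineCoeffs a 1 l +
    sw m' m'' f r s 2 * cw τ m' m'' f r s 2 * (h 2)⁻¹ * lineCoeffs a 2 l +
    sw m' m'' f r s p * cw τ m' m'' f r s p * (h p)⁻¹ * lineCoeffs a p l = 0 := by
  obtain ⟨-, -, h1, h3, -⟩ := hA
  have F := four_term τ hτ (fun k => m' (![0, 1, 2, p, f, r, s] k))
    (fun k => m'' (![0, 1, 2, p, f, r, s] k)) (fun k => h1 _)
    (fun x y z hxy hxz hyz => h3 _ _ _ (hi.ne hxy) (hi.ne hxz) (hi.ne hyz))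
  have F' : ∀ j : Fin 3, sw m' m'' f r s 0 * (thetaGrad 3 τ (m' 0) (m'' 0) j * cw τ m' m'' f r s 0) +
      sw m' m'' f r s 1 * (thetaGrad 3 τ (m' 1) (m'' 1) j * cw τ m' m'' f r s 1) +
      sw m' m'' f r s 2 * (thetaGrad 3 τ (m' 2) (m'' 2) j * cw τ m' m'' f r s 2) +
      sw m' m'' f r s p * (thetaGrad 3 τ (m' p) (m'' p) j * cw τ m' m'' f r s p) = 0 := by
    intro j
    simp only [cw, ← triple_eq]
    exact F j
  have q : ∀ k, (h k)⁻¹ * lineCoeffs a k l = ∑ j, thetaGrad 3 τ (m' k) (m'' k) j * A j l := by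
    intro k
    rw [hL, inv_mul_cancel_left₀ (hh k)]
  simp only [mul_assoc _ (h _)⁻¹, q, Fin.sum_univ_three]
  linear_combination A 0 l * F' 0 + A 1 l * F' 1 + A 2 l * F' 2

theorem core_alg {S S' p q p' q' w hj K K' a e : ℂ} (h1 : S * (p * (q * w)) * hj + K = 0)
    (h2 : S' * (p' * (q' * w)) * hj + K' * a = 0) (hS : S * S = 1) (he : S * S' = e)
    (hp : p ≠ 0) (hq : q ≠ 0) (hK : K' ≠ 0) :
    a = K * K'⁻¹ * e * (p' * q') / (p * q) := by
  rw [eq_div_iff (mul_ne_zero hp hq), ← mul_right_inj' hK]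
  have : K' * (K * K'⁻¹ * e * (p' * q')) = K * e * (p' * q') := by
    field_simp
  rw [this, ← he]
  linear_combination p * q * h2 - S * S' * p' * q' * h1 +
    S' * p' * q' * w * hj * p * q * hS

theorem sw_sq (m' m'' : Fin 7 → Fin 3 → ℤ) (f r s k : Fin 7) :
    sw m' m'' f r s k * sw m' m'' f r s k = 1 := eps_sq _

theorem sw_mul (m' m'' : Fin 7 → Fin 3 → ℤ) (f r s k : Fin 7) :
    sw m' m'' f r s k * sw m' m'' 3 r s k =
      Complex.exp (Real.pi * Complex.I * ((∑ t, m' k t * (m'' 3 t + m'' f t) : ℤ) : ℂ)) := by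
  change eps _ * eps _ = eps _
  rw [← eps_add]
  apply eps_congr
  refine ⟨∑ t, (m'' r t * m' k t + m' s t * m'' k t), ?_⟩
  simp only [Fin.sum_univ_three]
  ring

theorem weber_aux (τ : Matrix (Fin 3) (Fin 3) ℂ) (hτ : InSiegelUpperHalfSpace τ)
    (m' m'' : Fin 7 → Fin 3 → ℤ) (hA : IsAronholdChar m' m'')
    (hθ : ∀ p q r : Fin 7, p ≠ q → p ≠ r → q ≠ r → tripleThetaConst τ m' m'' p q r ≠ 0)
    (a : Fin 3 → Fin 3 → ℂ)
    (A : Matrix (Fin 3) (Fin 3) ℂ) (h : Fin 7 → ℂ) (hh : ∀ k, h k ≠ 0)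
    (hL : ∀ k l, lineCoeffs a k l = h k * ∑ j, thetaGrad 3 τ (m' k) (m'' k) j * A j l)
    (f r s : Fin 7) (hi : Function.Injective ![0, 1, 2, 3, f, r, s])
    (hi' : Function.Injective ![0, 1, 2, f, 3, r, s]) :
    ∃ η : ℂ, η ≠ 0 ∧ ∀ j : Fin 3, lineCoeffs a f j = η *
          Complex.exp (Real.pi * Complex.I *
            ((∑ t, m' (Fin.castLE (by norm_num) j) t * (m'' 3 t + m'' f t) : ℤ) : ℂ)) *
          (tripleThetaConst τ m' m'' 3 r (Fin.castLE (by norm_num) j) *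
            tripleThetaConst τ m' m'' 3 s (Fin.castLE (by norm_num) j)) /
          (tripleThetaConst τ m' m'' f r (Fin.castLE (by norm_num) j) *
            tripleThetaConst τ m' m'' f s (Fin.castLE (by norm_num) j)) := by
  have hfr : f ≠ r := hi.ne (a₁ := 4) (a₂ := 5) (by decide)
  have hfs : f ≠ s := hi.ne (a₁ := 4) (a₂ := 6) (by decide)
  have hrs : r ≠ s := hi.ne (a₁ := 5) (a₂ := 6) (by decide)
  have h3f : 3 ≠ f := hi.ne (a₁ := 3) (a₂ := 4) (by decide)
  have h3r : 3 ≠ r := hi.ne (a₁ := 3) (a₂ := 5) (by decide)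
  have h3s : 3 ≠ s := hi.ne (a₁ := 3) (a₂ := 6) (by decide)
  have n3 : sw m' m'' f r s 3 * cw τ m' m'' f r s 3 * (h 3)⁻¹ ≠ 0 :=
    mul_ne_zero (mul_ne_zero (eps_ne_zero _) (mul_ne_zero (hθ _ _ _ hfr h3f.symm h3r.symm)
      (mul_ne_zero (hθ _ _ _ hfs h3f.symm h3s.symm) (hθ _ _ _ hrs h3r.symm h3s.symm))))
      (inv_ne_zero (hh _))
  have nf : sw m' m'' 3 r s f * cw τ m' m'' 3 r s f * (h f)⁻¹ ≠ 0 :=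
    mul_ne_zero (mul_ne_zero (eps_ne_zero _) (mul_ne_zero (hθ _ _ _ h3r h3f hfr.symm)
      (mul_ne_zero (hθ _ _ _ h3s h3f hfs.symm) (hθ _ _ _ hrs hfr.symm hfs.symm))))
      (inv_ne_zero (hh _))
  refine ⟨_, mul_ne_zero n3 (inv_ne_zero nf), fun j => ?_⟩
  have E1 := line_rel τ hτ m' m'' hA a A h hh hL 3 f r s hi j
  have E2 := line_rel τ hτ m' m'' hA a A h hh hL f 3 r s hi' j
  have ne : ∀ j : Fin 3, f ≠ Fin.castLE (by norm_num) j ∧ r ≠ Fin.castLE (by norm_num) j ∧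
      s ≠ Fin.castLE (by norm_num) j := by
    intro j
    fin_cases j
    · exact ⟨hi.ne (a₁ := 4) (a₂ := 0) (by decide), hi.ne (a₁ := 5) (a₂ := 0) (by decide),
        hi.ne (a₁ := 6) (a₂ := 0) (by decide)⟩
    · exact ⟨hi.ne (a₁ := 4) (a₂ := 1) (by decide), hi.ne (a₁ := 5) (a₂ := 1) (by decide),
        hi.ne (a₁ := 6) (a₂ := 1) (by decide)⟩
    · exact ⟨hi.ne (a₁ := 4) (a₂ := 2) (by decide), hi.ne (a₁ := 5) (a₂ := 2) (by decide),
        hi.ne (a₁ := 6) (a₂ := 2) (by decide)⟩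
  obtain ⟨nef, ner, nes⟩ := ne j
  refine core_alg (w := tripleThetaConst τ m' m'' r s (Fin.castLE (by norm_num) j))
    (hj := (h (Fin.castLE (by norm_num) j))⁻¹) ?_ ?_
    (sw_sq m' m'' f r s (Fin.castLE (by norm_num) j))
    (sw_mul m' m'' f r s (Fin.castLE (by norm_num) j))
    (hθ _ _ _ hfr nef ner) (hθ _ _ _ hfs nef nes) nf
  · clear E2
    change sw m' m'' f r s (Fin.castLE _ j) * cw τ m' m'' f r s (Fin.castLE _ j) * _ + _ = 0
    rw [← E1]
    fin_cases j <;> simp [lineCoeffs]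
  · clear E1
    change sw m' m'' 3 r s (Fin.castLE _ j) * cw τ m' m'' 3 r s (Fin.castLE _ j) * _ + _ = 0
    rw [← E2]
    generalize lineCoeffs a f = L
    fin_cases j <;> simp [lineCoeffs]

/-- **Weber's formula.** Let `τ ∈ 𝔖₃` with Aronhold system of characteristics
`q₁, …, q₇` (indices `0, …, 6`), whose associated bitangents
`Σ_l (∂θ[q_k]/∂Z_l)(τ,0) Z_l = 0` are projectively normalized (via an invertible
change of coordinates `A` and scalars `h k ≠ 0`) to
`X₁, X₂, X₃, X₁+X₂+X₃` and `a_{i1}X₁+a_{i2}X₂+a_{i3}X₃` (`i = 1,2,3`). Then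
`a_{ij} = η_i · e(q_j'·(q₄+q_{4+i})'') ·
θ(q₄+q_r+q_j)θ(q₄+q_s+q_j) / (θ(q_{4+i}+q_r+q_j)θ(q_{4+i}+q_s+q_j))`
with `{4+i, r, s} = {5,6,7}` and `η_i ≠ 0` depending only on `i`. -/
theorem weber_formula (τ : Matrix (Fin 3) (Fin 3) ℂ)
    (hτ : InSiegelUpperHalfSpace τ)
    (m' m'' : Fin 7 → Fin 3 → ℤ)
    (hA : IsAronholdChar m' m'')
    (hθ : ∀ p q r : Fin 7, p ≠ q → p ≠ r → q ≠ r → tripleThetaConst τ m' m'' p q r ≠ 0)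
    (hD : ∀ p q r : Fin 7, p ≠ q → p ≠ r → q ≠ r →
      thetaJacDet τ ![(m' p, m'' p), (m' q, m'' q), (m' r, m'' r)] ≠ 0)
    (a : Fin 3 → Fin 3 → ℂ)
    (hnorm : ∃ (A : Matrix (Fin 3) (Fin 3) ℂ) (h : Fin 7 → ℂ), IsUnit A.det ∧
      (∀ k, h k ≠ 0) ∧
      ∀ k l, lineCoeffs a k l = h k * ∑ j, thetaGrad 3 τ (m' k) (m'' k) j * A j l) :
    ∃ η : Fin 3 → ℂ, (∀ i, η i ≠ 0) ∧
      ∀ i j : Fin 3, a i j =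
        η i *
          Complex.exp (Real.pi * Complex.I *
            ((∑ t, m' (Fin.castLE (by norm_num) j) t * (m'' 3 t + m'' (fIdx i) t) : ℤ) : ℂ)) *
          (tripleThetaConst τ m' m'' 3 (rIdx i) (Fin.castLE (by norm_num) j) *
            tripleThetaConst τ m' m'' 3 (sIdx i) (Fin.castLE (by norm_num) j)) /
          (tripleThetaConst τ m' m'' (fIdx i) (rIdx i) (Fin.castLE (by norm_num) j) *
            tripleThetaConst τ m' m'' (fIdx i) (sIdx i) (Fin.castLE (by norm_num) j)) := by
  obtain ⟨A, h, -, hh, hL⟩ := hnorm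
  have H : ∀ i : Fin 3, lineCoeffs a (fIdx i) = a i := by
    intro i
    fin_cases i <;> rfl
  have H2 : ∀ i : Fin 3, Function.Injective ![0, 1, 2, 3, fIdx i, rIdx i, sIdx i] ∧
      Function.Injective ![0, 1, 2, fIdx i, 3, rIdx i, sIdx i] := by
    decide
  choose η hη hη2 using fun i => weber_aux τ hτ m' m'' hA hθ a A h hh hL (fIdx i) (rIdx i)
    (sIdx i) (H2 i).1 (H2 i).2
  refine ⟨η, hη, fun i j => ?_⟩
  rw [← hη2 i j, H]
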